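/- Let β ∈ (0,1] and α > 0. For every real ω > 0, the Fourier–Laplace transform of the exciting kernel α f_β satisfies ∫_0^∞ e^{-iωτ} · α f_β(τ) dτ = α / (1 + (iω)^β), where f_β(τ) = τ^{β-1} E_{β,β}(-τ^β) and (iω)^β denotes the principal branch of the complex power. -/

import Mathlib

open MeasureTheory Set Filter

/-- The two-parameter Mittag-Leffler function `E_{γ,δ}(z) = ∑ zⁿ / Γ(nγ + δ)`. -/
noncomputable def ML2 (γ δ z : ℝ) : ℝ := ∑' n : ℕ, z ^ n / Real.Gamma (n * γ + δ)

/-- The one-parameter Mittag-Leffler function `E_β(z) = E_{β,1}(z)`. -/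
noncomputable def ML (β z : ℝ) : ℝ := ML2 β 1 z

/-- The Mittag-Leffler density `f_β(t) = t^{β-1} E_{β,β}(-t^β)`. -/
noncomputable def fML (β t : ℝ) : ℝ := t ^ (β - 1) * ML2 β β (-(t ^ β))

/-- The spectral kernel `K_β(θ)`. -/
noncomputable def Kspec (β θ : ℝ) : ℝ :=
  (1 / Real.pi) * (θ ^ (β - 1) * Real.sin (β * Real.pi)) /
    (θ ^ (2 * β) + 2 * θ ^ β * Real.cos (β * Real.pi) + 1)

lemma gamma_lb (R x : ℝ) (hR : 1 ≤ R) (hx : 1 ≤ x) :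
    R ^ (x - 1) * Real.exp (-(R + 1)) ≤ Real.Gamma x := by
  have hx0 : 0 < x := by linarith
  rw [Real.Gamma_eq_integral hx0]
  have hint := Real.GammaIntegral_convergent hx0
  have hsub : Ioc R (R + 1) ⊆ Ioi (0:ℝ) := fun y hy => lt_of_lt_of_le (by linarith) hy.1.le
  have h1 : ∫ y in Ioc R (R + 1), Real.exp (-y) * y ^ (x - 1) ≤
      ∫ y in Ioi (0:ℝ), Real.exp (-y) * y ^ (x - 1) := by
    apply setIntegral_mono_set hint
    · filter_upwards [ae_restrict_mem measurableSet_Ioi] with y hy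
      have : (0:ℝ) < y := hy
      positivity
    · exact hsub.eventuallyLE
  refine le_trans ?_ h1
  have h2 : ∫ y in Ioc R (R + 1), R ^ (x - 1) * Real.exp (-(R + 1)) ≤
      ∫ y in Ioc R (R + 1), Real.exp (-y) * y ^ (x - 1) := by
    apply setIntegral_mono_on _ (hint.mono_set hsub) measurableSet_Ioc
    · intro y hy
      rw [mul_comm]
      have hy1 := hy.1
      have hy2 := hy.2
      apply mul_le_mul
      · exact Real.exp_le_exp.2 (by linarith)
      · exact Real.rpow_le_rpow (by linarith) hy1.le (by linarith)
      · positivity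
      · positivity
    · exact integrableOn_const (by simp) (by finiteness)
  simpa using h2

lemma summable_ML (β δ : ℝ) (hβ : 0 < β) (z : ℝ) :
    Summable fun n : ℕ => z ^ n / Real.Gamma (n * β + δ) := by
  set M : ℝ := 2 * (|z| + 1) with hM
  have hM0 : 0 < M := by positivity
  have hM1 : 1 ≤ M := by have := abs_nonneg z; linarith
  set R : ℝ := M ^ (1 / β) with hR
  have hR1 : 1 ≤ R := Real.one_le_rpow hM1 (by positivity)
  have hR0 : 0 < R := by linarith
  have hRβ : R ^ β = M := by
    rw [hR, ← Real.rpow_mul hM0.le]; field_simp; simp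
  have hg : Summable fun n : ℕ => (Real.exp (R + 1) / R ^ (δ - 1)) * (1 / 2 : ℝ) ^ n :=
    (summable_geometric_of_lt_one (by norm_num) (by norm_num)).mul_left _
  refine Summable.of_norm_bounded_eventually_nat hg ?_
  have hev : ∀ᶠ n : ℕ in atTop, 1 ≤ (n : ℝ) * β + δ := by
    have : Tendsto (fun n : ℕ => (n : ℝ) * β + δ) atTop atTop :=
      tendsto_atTop_add_const_right _ _ (tendsto_natCast_atTop_atTop.atTop_mul_const hβ)
    exact this.eventually_ge_atTop 1
  filter_upwards [hev] with n hn
  have hlb := gamma_lb R _ hR1 hn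
  have e1 : R ^ ((n : ℝ) * β + δ - 1) = M ^ n * R ^ (δ - 1) := by
    rw [add_sub_assoc, Real.rpow_add hR0, mul_comm (n : ℝ) β, Real.rpow_mul hR0.le, hRβ,
      Real.rpow_natCast]
  rw [e1, Real.exp_neg] at hlb
  have hRp : 0 < R ^ (δ - 1) := Real.rpow_pos_of_pos hR0 _
  have hpos : 0 < M ^ n * R ^ (δ - 1) * (Real.exp (R + 1))⁻¹ := by positivity
  rw [norm_div, norm_pow, Real.norm_eq_abs, Real.norm_of_nonneg (hpos.le.trans hlb)]
  calc |z| ^ n / Real.Gamma (n * β + δ)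
      ≤ |z| ^ n / (M ^ n * R ^ (δ - 1) * (Real.exp (R + 1))⁻¹) := by gcongr
    _ = (Real.exp (R + 1) / R ^ (δ - 1)) * (|z| / M) ^ n := by
        rw [div_pow]; field_simp
    _ ≤ _ := by
        have hq : |z| / M ≤ 1 / 2 := by
          rw [div_le_div_iff₀ hM0 (by norm_num)]
          linarith
        gcongr

lemma ML2_diff (β δ : ℝ) (hβ : 0 < β) (hδ : 0 < δ) : Differentiable ℝ (ML2 β δ) := by
  intro x
  let c : ℕ → ℝ := fun n => (Real.Gamma (n * β + δ))⁻¹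
  have hc : ∀ n, 0 < c n := fun n => inv_pos.2 (Real.Gamma_pos_of_pos (by positivity))
  let F : ℂ → ℂ := fun z => ∑' n : ℕ, z ^ n * (c n : ℂ)
  have hd : DifferentiableOn ℂ F (Metric.ball 0 (|x| + 1)) := by
    refine Complex.differentiableOn_tsum_of_summable_norm
      (u := fun n : ℕ => (|x| + 1) ^ n * c n) ?_ ?_ Metric.isOpen_ball ?_
    · simpa [c, div_eq_mul_inv] using summable_ML β δ hβ (|x| + 1)
    · intro n; fun_prop
    · intro n w hw
      have hw' : ‖w‖ < |x| + 1 := by simpa using hw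
      rw [norm_mul, norm_pow, Complex.norm_real, Real.norm_of_nonneg (hc n).le]
      have := hc n
      gcongr
  have hda : DifferentiableAt ℂ F (x : ℂ) := by
    refine hd.differentiableAt (Metric.isOpen_ball.mem_nhds ?_)
    simp
  have hr := hda.hasDerivAt.real_of_complex.differentiableAt
  convert! hr using 1
  funext y
  have : F (y : ℂ) = ((ML2 β δ y : ℝ) : ℂ) := by
    simp only [F, ML2, c]
    push_cast
    simp [div_eq_mul_inv]
  rw [this, Complex.ofReal_re]

lemma rpow_neg_diff (β T x y : ℝ) (hβ0 : 0 < β) (hy : 0 < y) (hyx : y ≤ x) (hxT : x ≤ T) :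
    β * T ^ (-β - 1) * (x - y) ≤ y ^ (-β) - x ^ (-β) := by
  have hx : 0 < x := hy.trans_le hyx
  have hT : 0 < T := hx.trans_le hxT
  have h1 : 1 + β * (1 - y / x) ≤ (y / x) ^ (-β) := by
    rw [Real.rpow_def_of_pos (by positivity)]
    have ha := Real.add_one_le_exp (Real.log (y / x) * -β)
    have hb := Real.log_le_sub_one_of_pos (show 0 < y / x by positivity)
    nlinarith
  have h2 : y ^ (-β) = (y / x) ^ (-β) * x ^ (-β) := by
    rw [← Real.mul_rpow (by positivity) hx.le]; congr 1; field_simp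
  have hxp : 0 < x ^ (-β) := Real.rpow_pos_of_pos hx _
  have h3 : T ^ (-β - 1) ≤ x ^ (-β - 1) :=
    Real.rpow_le_rpow_of_nonpos hx hxT (by linarith)
  have h4 : x ^ (-β - 1) = x ^ (-β) / x := by rw [Real.rpow_sub hx, Real.rpow_one]
  calc β * T ^ (-β - 1) * (x - y) ≤ β * (x ^ (-β) / x) * (x - y) := by
        rw [← h4]
        have : 0 ≤ x - y := by linarith
        gcongr
    _ = β * (1 - y / x) * x ^ (-β) := by field_simp
    _ ≤ ((y / x) ^ (-β) - 1) * x ^ (-β) := by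
        apply mul_le_mul_of_nonneg_right _ hxp.le; linarith
    _ = _ := by rw [h2]; ring

lemma pos_of_volterra (f : ℝ → ℝ) (β c : ℝ) (hβ0 : 0 < β) (hβ1 : β < 1) (hc : 0 < c)
    (hd : ∀ t > 0, DifferentiableAt ℝ f t)
    (hpos0 : ∀ᶠ t in nhdsWithin (0:ℝ) (Ioi 0), 0 < f t)
    (hfi : ∀ t > 0, IntervalIntegrable f volume 0 t)
    (hki : ∀ t > 0, IntervalIntegrable (fun s => (1 + c * (t - s) ^ (-β)) * f s) volume 0 t)
    (hI : ∀ t > 0, ∫ s in (0:ℝ)..t, (1 + c * (t - s) ^ (-β)) * f s = 1) :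
    ∀ t > 0, 0 < f t := by
  by_contra hcon
  push Not at hcon
  obtain ⟨t1, ht1, hft1⟩ := hcon
  set S : Set ℝ := {t | 0 < t ∧ f t ≤ 0} with hS
  have hSne : S.Nonempty := ⟨t1, ht1, hft1⟩
  obtain ⟨ε, hε, hεpos⟩ := mem_nhdsGT_iff_exists_Ioo_subset.1 hpos0
  have hε0 : (0:ℝ) < ε := hε
  have hlb : ∀ t ∈ S, ε ≤ t := by
    intro t ht
    by_contra hlt
    push Not at hlt
    have : 0 < f t := hεpos ⟨ht.1, hlt⟩
    exact absurd ht.2 (not_le.2 this)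
  have hbdd : BddBelow S := ⟨ε, hlb⟩
  set T := sInf S with hTdef
  have hT : 0 < T := hε0.trans_le (le_csInf hSne hlb)
  have hfpos : ∀ s, 0 < s → s < T → 0 < f s := by
    intro s hs hsT
    by_contra hneg
    exact notMem_of_lt_csInf hsT hbdd ⟨hs, not_lt.1 hneg⟩
  have hcT : ContinuousAt f T := (hd T hT).continuousAt
  have hfT : f T = 0 := by
    apply le_antisymm
    · by_contra hgt
      push Not at hgt
      have h1 : ∀ᶠ t in nhds T, 0 < f t := hcT.eventually (lt_mem_nhds hgt)
      have h2 := mem_closure_iff_frequently.1 (csInf_mem_closure hSne hbdd)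
      obtain ⟨t, ht, ht'⟩ := (h2.and_eventually h1).exists
      exact absurd ht.2 (not_le.2 ht')
    · have h1 : Tendsto f (nhdsWithin T (Iio T)) (nhds (f T)) := hcT.mono_left nhdsWithin_le_nhds
      refine ge_of_tendsto h1 ?_
      filter_upwards [Ioo_mem_nhdsLT hT] with s hs
      exact (hfpos s hs.1 hs.2).le
  -- mass
  set A := ∫ s in (0:ℝ)..(T/2), f s with hA
  have hApos : 0 < A := by
    apply intervalIntegral.intervalIntegral_pos_of_pos_on (hfi _ (by positivity)) _ (by positivity)
    intro s hs
    exact hfpos s hs.1 (by linarith [hs.2])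
  set δ := c * (β * T ^ (-β - 1)) with hδ
  have hδpos : 0 < δ := by have := Real.rpow_pos_of_pos hT (-β - 1); positivity
  -- smallness near T
  have hsmall : Tendsto (fun s => (1 + c * (T - s) ^ (-β)) * f s) (nhdsWithin T (Iio T)) (nhds 0) := by
    have hO := (hd T hT).isBigO_sub
    simp only [hfT, sub_zero] at hO
    obtain ⟨C, hC⟩ := hO.bound
    have hub : ∀ᶠ s in nhdsWithin T (Iio T),
        ‖(1 + c * (T - s) ^ (-β)) * f s‖ ≤ C * ((T - s) + c * (T - s) ^ (1 - β)) := by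
      filter_upwards [hC.filter_mono nhdsWithin_le_nhds, self_mem_nhdsWithin] with s hs hsT
      have hsT' : 0 < T - s := sub_pos.2 hsT
      have hp := Real.rpow_pos_of_pos hsT' (-β)
      rw [norm_mul, Real.norm_of_nonneg (by positivity)]
      have e : ‖s - T‖ = T - s := by rw [norm_sub_rev, Real.norm_of_nonneg hsT'.le]
      rw [e] at hs
      have e2 : (T - s) ^ (1 - β) = (T - s) * (T - s) ^ (-β) := by
        rw [sub_eq_add_neg 1 β, Real.rpow_add hsT', Real.rpow_one]
      rw [e2]
      calc _ ≤ (1 + c * (T - s) ^ (-β)) * (C * (T - s)) := by gcongr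
        _ = _ := by ring
    refine squeeze_zero_norm' hub ?_
    have hcont : ContinuousAt (fun s => C * ((T - s) + c * (T - s) ^ (1 - β))) T := by
      have : ContinuousAt (fun s => (T - s) ^ (1 - β)) T :=
        ContinuousAt.rpow_const (by fun_prop) (Or.inr (by linarith))
      fun_prop
    have := hcont.tendsto.mono_left (nhdsWithin_le_nhds (s := Iio T))
    simpa [Real.zero_rpow (show 1 - β ≠ 0 by linarith)] using this
  have hev := hsmall.eventually (gt_mem_nhds (show (0:ℝ) < δ * A / 2 by positivity))
  obtain ⟨a, ha, haT⟩ := mem_nhdsLT_iff_exists_Ioo_subset.1 hev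
  have haT' : a < T := ha
  -- choose h
  set r := max a (T/2) with hr
  have hrT : r < T := max_lt haT' (by linarith)
  have hr2 : T/2 ≤ r := le_max_right _ _
  have hr0 : 0 < r := by linarith
  have hra : a ≤ r := le_max_left _ _
  have i1 : IntervalIntegrable (fun s => (1 + c * (T - s) ^ (-β)) * f s) volume 0 r :=
    (hki T hT).mono_set (by
      rw [uIcc_of_le hr0.le, uIcc_of_le hT.le]; exact Icc_subset_Icc le_rfl hrT.le)
  have i2 : IntervalIntegrable (fun s => (1 + c * (T - s) ^ (-β)) * f s) volume r T :=
    (hki T hT).mono_set (by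
      rw [uIcc_of_le hrT.le, uIcc_of_le hT.le]; exact Icc_subset_Icc hr0.le le_rfl)
  have hsplit := intervalIntegral.integral_add_adjacent_intervals i1 i2
  rw [hI T hT] at hsplit
  have hIr := hI r hr0
  have b1 : ∫ s in r..T, (1 + c * (T - s) ^ (-β)) * f s ≤ ∫ s in r..T, δ * A / 2 := by
    apply intervalIntegral.integral_mono_on_of_le_Ioo hrT.le i2 (by simp)
    intro s hs
    exact le_of_lt (haT ⟨lt_of_le_of_lt hra hs.1, hs.2⟩)
  rw [intervalIntegral.integral_const, smul_eq_mul] at b1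
  have b2 : ∫ s in (0:ℝ)..r, (δ * (T - r)) * f s ≤
      ∫ s in (0:ℝ)..r, ((1 + c * (r - s) ^ (-β)) * f s - (1 + c * (T - s) ^ (-β)) * f s) := by
    apply intervalIntegral.integral_mono_on_of_le_Ioo hr0.le ((hfi r hr0).const_mul _)
      ((hki r hr0).sub i1)
    intro s hs
    have hf := hfpos s hs.1 (hs.2.trans hrT)
    have hk := rpow_neg_diff β T (T - s) (r - s) hβ0 (by linarith [hs.2]) (by linarith)
      (by linarith [hs.1])
    rw [← sub_mul]
    apply mul_le_mul_of_nonneg_right _ hf.le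
    have := mul_le_mul_of_nonneg_left hk hc.le
    rw [hδ]
    nlinarith
  rw [intervalIntegral.integral_sub (hki r hr0) i1, hIr, intervalIntegral.integral_const_mul] at b2
  have b3 : A ≤ ∫ s in (0:ℝ)..r, f s := by
    have j : IntervalIntegrable f volume (T/2) r := (hfi r hr0).mono_set (by
      rw [uIcc_of_le hr2, uIcc_of_le hr0.le]; exact Icc_subset_Icc (by linarith) le_rfl)
    rw [← intervalIntegral.integral_add_adjacent_intervals (hfi (T/2) (by positivity)) j]
    have : 0 ≤ ∫ s in (T/2)..r, f s := by
      apply intervalIntegral.integral_nonneg hr2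
      intro s hs
      exact (hfpos s (by linarith [hs.1]) (by linarith [hs.2])).le
    linarith
  have b4 : δ * (T - r) * A ≤ δ * (T - r) * ∫ s in (0:ℝ)..r, f s :=
    mul_le_mul_of_nonneg_left b3 (by have : 0 < T - r := by linarith
                                     positivity)
  have : 0 < (T - r) * (δ * A) := by
    have : 0 < T - r := by linarith
    positivity
  nlinarith

lemma beta_real (a b t : ℝ) (ha : 0 < a) (hb : 0 < b) (ht : 0 < t) :
    ∫ s in (0:ℝ)..t, s ^ (a - 1) * (t - s) ^ (b - 1) =
      t ^ (a + b - 1) * (Real.Gamma a * Real.Gamma b / Real.Gamma (a + b)) := by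
  have h := Complex.betaIntegral_scaled a b ht
  rw [Complex.betaIntegral_eq_Gamma_mul_div a b (by simpa) (by simpa)] at h
  have h2 : ∫ x in (0:ℝ)..t, (x : ℂ) ^ ((a:ℂ) - 1) * ((t : ℂ) - x) ^ ((b:ℂ) - 1) =
      ∫ x in (0:ℝ)..t, ((x ^ (a - 1) * (t - x) ^ (b - 1) : ℝ) : ℂ) := by
    apply intervalIntegral.integral_congr
    intro x hx
    rw [uIcc_of_le ht.le] at hx
    simp only
    rw [Complex.ofReal_mul, Complex.ofReal_cpow hx.1, Complex.ofReal_cpow (sub_nonneg.2 hx.2)]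
    push_cast
    rfl
  rw [h2, intervalIntegral.integral_ofReal] at h
  apply Complex.ofReal_injective
  rw [h]
  simp only [Complex.ofReal_mul, Complex.ofReal_div, Complex.ofReal_cpow ht.le,
    ← Complex.Gamma_ofReal]
  push_cast
  rfl

lemma beta_real_int (a b t : ℝ) (ha : 0 < a) (hb : 0 < b) (ht : 0 < t) :
    IntervalIntegrable (fun s => s ^ (a - 1) * (t - s) ^ (b - 1)) volume 0 t := by
  by_contra h
  have h1 := beta_real a b t ha hb ht
  rw [intervalIntegral.integral_undef h] at h1
  have h2 := Real.Gamma_pos_of_pos ha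
  have h3 := Real.Gamma_pos_of_pos hb
  have h4 := Real.Gamma_pos_of_pos (add_pos ha hb)
  have h5 := Real.rpow_pos_of_pos ht (a + b - 1)
  have : 0 < t ^ (a + b - 1) * (Real.Gamma a * Real.Gamma b / Real.Gamma (a + b)) := by positivity
  linarith

lemma volterra_id (β t : ℝ) (hβ0 : 0 < β) (hβ1 : β < 1) (ht : 0 < t) :
    ∫ s in (0:ℝ)..t, (1 + (Real.Gamma (1 - β))⁻¹ * (t - s) ^ (-β)) * fML β s = 1 := by
  set c := (Real.Gamma (1 - β))⁻¹ with hc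
  have hG := Real.Gamma_pos_of_pos (show 0 < 1 - β by linarith)
  have hcpos : 0 < c := inv_pos.2 hG
  let a : ℕ → ℝ := fun n => n * β + β
  have ha : ∀ n, 0 < a n := fun n => by positivity
  have hGa : ∀ n, 0 < Real.Gamma (a n) := fun n => Real.Gamma_pos_of_pos (ha n)
  let v : ℕ → ℝ → ℝ := fun n s => (Real.Gamma (a n))⁻¹ *
    (s ^ (a n - 1) * (t - s) ^ ((1:ℝ) - 1) + c * (s ^ (a n - 1) * (t - s) ^ ((1 - β) - 1)))
  let b : ℕ → ℝ := fun n => (t ^ β) ^ n / Real.Gamma (n * β + 1)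
  let d : ℕ → ℝ := fun n => (-(t ^ β)) ^ n / Real.Gamma (n * β + 1)
  have hbs : Summable b := summable_ML β 1 hβ0 _
  have hds : Summable d := summable_ML β 1 hβ0 _
  have hb0 : ∀ n : ℕ, t ^ ((n:ℝ) * β) = (t ^ β) ^ n := fun n => by
    rw [mul_comm, Real.rpow_mul ht.le, Real.rpow_natCast]
  have hvint : ∀ n, IntervalIntegrable (v n) volume 0 t := fun n =>
    ((beta_real_int (a n) 1 t (ha n) one_pos ht).add
      ((beta_real_int (a n) (1 - β) t (ha n) (by linarith) ht).const_mul c)).const_mul _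
  have hv : ∀ n, ∫ s in (0:ℝ)..t, v n s = b (n + 1) + b n := by
    intro n
    simp only [v]
    rw [intervalIntegral.integral_const_mul, intervalIntegral.integral_add
      (beta_real_int (a n) 1 t (ha n) one_pos ht)
      ((beta_real_int (a n) (1 - β) t (ha n) (by linarith) ht).const_mul c),
      intervalIntegral.integral_const_mul, beta_real _ _ _ (ha n) one_pos ht,
      beta_real _ _ _ (ha n) (by linarith) ht]
    have e1 : a n + 1 - 1 = ((n + 1 : ℕ) : ℝ) * β := by simp only [a]; push_cast; ring
    have e2 : a n + 1 = ((n + 1 : ℕ) : ℝ) * β + 1 := by simp only [a]; push_cast; ring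
    have e3 : a n + (1 - β) - 1 = (n : ℝ) * β := by simp only [a]; ring
    have e4 : a n + (1 - β) = (n : ℝ) * β + 1 := by simp only [a]; ring
    rw [e1, e2, e3, e4, hb0, hb0, Real.Gamma_one, hc]
    have := (hGa n).ne'
    simp only [b]
    field_simp
  have hvnn : ∀ n, ∀ s ∈ Ioc (0:ℝ) t, 0 ≤ v n s := by
    intro n s hs
    have h1 : 0 ≤ t - s := sub_nonneg.2 hs.2
    have h2 := hs.1
    have := hGa n
    simp only [v]
    positivity
  let F : ℕ → ℝ → ℝ := fun n s => (-1) ^ n * v n s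
  have hnorm : ∀ n, ∫ s in Ioc 0 t, ‖F n s‖ = b (n + 1) + b n := by
    intro n
    rw [← hv n, intervalIntegral.integral_of_le ht.le]
    apply setIntegral_congr_fun measurableSet_Ioc
    intro s hs
    simp only [F]
    rw [norm_mul, norm_pow, norm_neg, norm_one, one_pow, one_mul,
      Real.norm_of_nonneg (hvnn n s hs)]
  have hFs := hasSum_integral_of_summable_integral_norm (μ := volume.restrict (Ioc 0 t)) (F := F)
    (fun n => ((intervalIntegrable_iff_integrableOn_Ioc_of_le ht.le).1 (hvint n)).const_mul _) (by
      simp only [hnorm]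
      exact ((summable_nat_add_iff 1).2 hbs).add hbs)
  have hFi : ∀ n, ∫ s in Ioc 0 t, F n s = d n - d (n + 1) := by
    intro n
    simp only [F]
    rw [integral_const_mul, ← intervalIntegral.integral_of_le ht.le, hv n]
    simp only [b, d]
    rw [neg_pow (t ^ β) n, neg_pow (t ^ β) (n + 1)]
    ring
  simp only [hFi] at hFs
  have hsum : HasSum (fun n => d n - d (n + 1)) 1 := by
    have h1 := hds.hasSum
    have h2 := (hasSum_nat_add_iff' 1).2 h1
    have h3 := h1.sub h2
    have : d 0 = 1 := by simp [d]
    simpa [this] using h3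
  rw [intervalIntegral.integral_of_le ht.le]
  refine Eq.trans ?_ (hFs.unique hsum)
  apply setIntegral_congr_fun measurableSet_Ioc
  intro s hs
  simp only [fML, ML2]
  rw [← mul_assoc, ← tsum_mul_left]
  congr 1
  funext n
  simp only [F, v]
  have e1 : s ^ (a n - 1) = (s ^ β) ^ n * s ^ (β - 1) := by
    rw [← Real.rpow_natCast (s ^ β), ← Real.rpow_mul hs.1.le, ← Real.rpow_add hs.1]
    congr 1; simp only [a]; ring
  rw [e1, neg_pow (s ^ β) n, sub_self, Real.rpow_zero, show (1 - β - 1) = -β by ring]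
  simp only [a]
  ring

lemma fML_cont (β : ℝ) (hβ0 : 0 < β) : Continuous fun s : ℝ => ML2 β β (-(s ^ β)) := by
  have h1 : Continuous fun s : ℝ => s ^ β := Real.continuous_rpow_const hβ0.le
  exact (ML2_diff β β hβ0 hβ0).continuous.comp h1.neg

lemma fML_pos (β : ℝ) (hβ0 : 0 < β) (hβ1 : β < 1) : ∀ t > 0, 0 < fML β t := by
  have hG := Real.Gamma_pos_of_pos (show 0 < 1 - β by linarith)
  refine pos_of_volterra (fML β) β (Real.Gamma (1 - β))⁻¹ hβ0 hβ1 (inv_pos.2 hG) ?_ ?_ ?_ ?_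
    (fun t ht => volterra_id β t hβ0 hβ1 ht)
  · intro t ht
    have h1 : DifferentiableAt ℝ (fun s : ℝ => s ^ β) t :=
      (Real.hasDerivAt_rpow_const (Or.inl ht.ne')).differentiableAt
    have h2 : DifferentiableAt ℝ (fun s : ℝ => s ^ (β - 1)) t :=
      (Real.hasDerivAt_rpow_const (Or.inl ht.ne')).differentiableAt
    have h3 : DifferentiableAt ℝ (fun s : ℝ => ML2 β β (-(s ^ β))) t :=
      (ML2_diff β β hβ0 hβ0 _).comp t h1.neg
    exact h2.mul h3
  · have h0 : 0 < ML2 β β (-((0:ℝ) ^ β)) := by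
      rw [Real.zero_rpow hβ0.ne', neg_zero, ML2, tsum_eq_single 0]
      · have := Real.Gamma_pos_of_pos hβ0
        simpa using this
      · intro n hn; simp [hn]
    have h1 : ∀ᶠ s in nhds (0:ℝ), 0 < ML2 β β (-(s ^ β)) :=
      (fML_cont β hβ0).continuousAt.eventually (lt_mem_nhds h0)
    filter_upwards [h1.filter_mono nhdsWithin_le_nhds, self_mem_nhdsWithin] with s hs hs0
    exact mul_pos (Real.rpow_pos_of_pos hs0 _) hs
  · intro t ht
    exact (intervalIntegral.intervalIntegrable_rpow' (by linarith)).mul_continuousOn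
      (fML_cont β hβ0).continuousOn
  · intro t ht
    by_contra h
    have := volterra_id β t hβ0 hβ1 ht
    rw [intervalIntegral.integral_undef h] at this
    exact zero_ne_one this

lemma fML_integrable (β : ℝ) (hβ0 : 0 < β) (hβ1 : β < 1) : IntegrableOn (fML β) (Ioi 0) := by
  have hG := Real.Gamma_pos_of_pos (show 0 < 1 - β by linarith)
  have hii : ∀ t, IntervalIntegrable (fML β) volume 0 t := fun t =>
    (intervalIntegral.intervalIntegrable_rpow' (by linarith)).mul_continuousOn
      (fML_cont β hβ0).continuousOn
  refine integrableOn_Ioi_of_intervalIntegral_norm_bounded (l := atTop) (b := fun x : ℝ => x)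
    1 0 ?_ tendsto_id ?_
  · intro t
    exact (hii t).1
  · filter_upwards [eventually_gt_atTop 0] with t ht
    have h1 := volterra_id β t hβ0 hβ1 ht
    rw [← h1]
    apply intervalIntegral.integral_mono_on_of_le_Ioo ht.le (hii t).norm
    · by_contra h
      rw [intervalIntegral.integral_undef h] at h1
      exact zero_ne_one h1
    · intro s hs
      have hp := fML_pos β hβ0 hβ1 s hs.1
      rw [Real.norm_of_nonneg hp.le]
      have := Real.rpow_pos_of_pos (sub_pos.2 hs.2) (-β)
      have h2 : 0 ≤ (Real.Gamma (1 - β))⁻¹ * (t - s) ^ (-β) := by positivity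
      nlinarith

lemma gam_int (a s : ℝ) (ha : 0 < a) (hs : 0 < s) :
    IntegrableOn (fun t : ℝ => t ^ (a - 1) * Real.exp (-(s * t))) (Ioi 0) := by
  by_contra h
  have h1 := Real.integral_rpow_mul_exp_neg_mul_Ioi ha hs
  rw [integral_undef h] at h1
  have := Real.Gamma_pos_of_pos ha
  have : 0 < (1 / s) ^ a * Real.Gamma a := by positivity
  linarith

lemma laplace_real (β s : ℝ) (hβ0 : 0 < β) (hβ1 : β < 1) (hs : 0 < s) :
    (1 + s ^ β) * ∫ x in Ioi (0:ℝ), Real.exp (-(s * x)) * fML β x = 1 := by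
  set c := (Real.Gamma (1 - β))⁻¹ with hc
  have hG := Real.Gamma_pos_of_pos (show 0 < 1 - β by linarith)
  have hb : 0 < 1 - β := by linarith
  have hf : IntegrableOn (fun x : ℝ => Real.exp (-(s * x)) * fML β x) (Ioi 0) := by
    refine Integrable.bdd_mul (c := 1) (fML_integrable β hβ0 hβ1) (by fun_prop) ?_
    filter_upwards [ae_restrict_mem measurableSet_Ioi] with x hx
    have hx0 : (0:ℝ) < x := hx
    rw [Real.norm_of_nonneg (Real.exp_pos _).le, Real.exp_le_one_iff]
    have : 0 < s * x := by positivity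
    linarith
  have g1 := gam_int 1 s one_pos hs
  have g2 := (gam_int (1 - β) s hb hs).const_mul c
  have hk := g1.add g2
  have hconv := integral_posConvolution (μ := volume) (ν := volume) hf hk
    (ContinuousLinearMap.mul ℝ ℝ)
  simp only [ContinuousLinearMap.mul_apply', Pi.add_apply] at hconv
  rw [integral_add g1 g2, integral_const_mul, Real.integral_rpow_mul_exp_neg_mul_Ioi one_pos hs,
    Real.integral_rpow_mul_exp_neg_mul_Ioi hb hs] at hconv
  have hl : ∫ x in Ioi (0:ℝ), ∫ t in (0:ℝ)..x, Real.exp (-(s * t)) * fML β t *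
      ((x - t) ^ ((1:ℝ) - 1) * Real.exp (-(s * (x - t))) +
        c * ((x - t) ^ (1 - β - 1) * Real.exp (-(s * (x - t))))) = 1 / s := by
    have e : 1 / s = ∫ x in Ioi (0:ℝ), x ^ ((1:ℝ) - 1) * Real.exp (-(s * x)) := by
      rw [Real.integral_rpow_mul_exp_neg_mul_Ioi one_pos hs]; simp
    rw [e]
    apply setIntegral_congr_fun measurableSet_Ioi
    intro x hx
    simp only [sub_self, Real.rpow_zero, one_mul]
    refine Eq.trans ?_ ((congrArg (fun y => Real.exp (-(s * x)) * y)
      (volterra_id β x hβ0 hβ1 hx)).trans (mul_one _))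
    rw [← intervalIntegral.integral_const_mul]
    apply intervalIntegral.integral_congr
    intro t _
    simp only
    have : Real.exp (-(s * x)) = Real.exp (-(s * t)) * Real.exp (-(s * (x - t))) := by
      rw [← Real.exp_add]; congr 1; ring
    rw [this, show (1 - β - 1) = -β by ring]
    ring
  rw [hl] at hconv
  have e2 : (1 / s) ^ (1 - β) = s ^ β / s := by
    rw [one_div, Real.inv_rpow hs.le, ← Real.rpow_neg hs.le, neg_sub, Real.rpow_sub hs,
      Real.rpow_one]
  rw [e2, Real.Gamma_one, Real.rpow_one, hc] at hconv
  field_simp at hconv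
  linarith

lemma laplace_diff (f : ℝ → ℝ) (hf : IntegrableOn f (Ioi 0)) :
    DifferentiableOn ℂ (fun z : ℂ => ∫ x in Ioi (0:ℝ), Complex.exp (-(z * x)) * (f x : ℂ))
      {z | 0 < z.re} := by
  intro z hz
  have hz0 : 0 < z.re := hz
  set ε := z.re / 2 with hε
  have hε0 : 0 < ε := by positivity
  have hfc : Integrable (fun x => (f x : ℂ)) (volume.restrict (Ioi 0)) := hf.ofReal
  have hm : ∀ w : ℂ, AEStronglyMeasurable (fun x : ℝ => Complex.exp (-(w * x)) * (f x : ℂ))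
      (volume.restrict (Ioi 0)) := fun w =>
    (by fun_prop : Continuous fun x : ℝ => Complex.exp (-(w * x))).aestronglyMeasurable.mul
      hfc.aestronglyMeasurable
  have key := hasDerivAt_integral_of_dominated_loc_of_deriv_le
    (μ := volume.restrict (Ioi (0:ℝ)))
    (F := fun (w : ℂ) (x : ℝ) => Complex.exp (-(w * x)) * (f x : ℂ))
    (F' := fun (w : ℂ) (x : ℝ) => Complex.exp (-(w * x)) * (-x) * (f x : ℂ))
    (x₀ := z) (s := Metric.ball z ε) (bound := fun x => (1 / ε) * |f x|)
    (Metric.ball_mem_nhds z hε0) (Eventually.of_forall hm) ?_ ?_ ?_ ?_ ?_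
  · exact key.2.differentiableAt.differentiableWithinAt
  · refine Integrable.bdd_mul (c := 1) hfc (by fun_prop) ?_
    filter_upwards [ae_restrict_mem measurableSet_Ioi] with x hx
    have hx0 : (0:ℝ) < x := hx
    rw [Complex.norm_exp, Real.exp_le_one_iff]
    simp
    positivity
  · exact (by fun_prop : Continuous fun x : ℝ => Complex.exp (-(z * x)) * (-x)).aestronglyMeasurable.mul
      hfc.aestronglyMeasurable
  · filter_upwards [ae_restrict_mem measurableSet_Ioi] with x hx w hw
    have hx0 : (0:ℝ) < x := hx
    have hwre : ε ≤ w.re := by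
      have h1 : ‖w - z‖ < ε := by simpa [dist_eq_norm] using hw
      have h2 := (abs_le.1 (Complex.abs_re_le_norm (w - z))).1
      rw [Complex.sub_re] at h2
      linarith
    rw [norm_mul, norm_mul, Complex.norm_real, norm_neg, Complex.norm_real, Complex.norm_exp,
      Real.norm_of_nonneg hx0.le, Real.norm_eq_abs]
    apply mul_le_mul_of_nonneg_right _ (abs_nonneg _)
    have e : (-(w * (x:ℂ))).re = -(w.re * x) := by simp
    rw [e]
    have h3 : Real.exp (-(w.re * x)) ≤ Real.exp (-(ε * x)) := by
      apply Real.exp_le_exp.2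
      nlinarith
    have h4 : ε * x ≤ Real.exp (ε * x) := by linarith [Real.add_one_le_exp (ε * x)]
    calc Real.exp (-(w.re * x)) * x ≤ Real.exp (-(ε * x)) * x := by gcongr
      _ = (ε * x) / Real.exp (ε * x) / ε := by rw [Real.exp_neg]; field_simp
      _ ≤ 1 / ε := by
        gcongr
        exact (div_le_one (Real.exp_pos _)).2 h4
  · exact hf.abs.const_mul _
  · filter_upwards with x w hw
    have h1 : HasDerivAt (fun w : ℂ => -(w * x)) (-(x:ℂ)) w := by
      have h0 := ((hasDerivAt_id w).mul_const (x:ℂ)).neg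
      rw [one_mul] at h0
      exact h0
    exact h1.cexp.mul_const _

lemma laplace_half (β : ℝ) (hβ0 : 0 < β) (hβ1 : β < 1) (z : ℂ) (hz : 0 < z.re) :
    (1 + z ^ (β:ℂ)) * ∫ x in Ioi (0:ℝ), Complex.exp (-(z * x)) * (fML β x : ℂ) = 1 := by
  have hopen : IsOpen {z : ℂ | 0 < z.re} := isOpen_lt continuous_const Complex.continuous_re
  have hd : DifferentiableOn ℂ (fun z : ℂ => (1 + z ^ (β:ℂ)) *
      ∫ x in Ioi (0:ℝ), Complex.exp (-(z * x)) * (fML β x : ℂ)) {z | 0 < z.re} := by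
    refine DifferentiableOn.mul ?_ (laplace_diff _ (fML_integrable β hβ0 hβ1))
    intro w hw
    refine DifferentiableAt.differentiableWithinAt ?_
    refine (differentiableAt_const _).add ?_
    exact differentiableAt_id.cpow (differentiableAt_const _) (Or.inl hw)
  have ha := hd.analyticOnNhd hopen
  have hconn : IsPreconnected {z : ℂ | 0 < z.re} := (convex_halfSpace_re_gt 0).isPreconnected
  have hfr : ∃ᶠ w in nhdsWithin (1:ℂ) {1}ᶜ, (1 + w ^ (β:ℂ)) *
      ∫ x in Ioi (0:ℝ), Complex.exp (-(w * x)) * (fML β x : ℂ) = 1 := by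
    have ht : Tendsto (fun r : ℝ => (r : ℂ)) (nhdsWithin 1 (Ioi 1)) (nhdsWithin (1:ℂ) {1}ᶜ) := by
      apply tendsto_nhdsWithin_iff.2
      constructor
      · have := Complex.continuous_ofReal.tendsto 1
        rw [Complex.ofReal_one] at this
        exact this.mono_left nhdsWithin_le_nhds
      · filter_upwards [self_mem_nhdsWithin] with r hr
        have hr1 : (1:ℝ) < r := hr
        simp only [mem_compl_iff, mem_singleton_iff]
        exact_mod_cast hr1.ne'
    refine ht.frequently (Eventually.frequently ?_)
    filter_upwards [self_mem_nhdsWithin] with r hr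
    have hr1 : (1:ℝ) < r := hr
    have hr0 : 0 < r := by linarith
    have h := congrArg (fun y : ℝ => (y : ℂ)) (laplace_real β r hβ0 hβ1 hr0)
    rw [Complex.ofReal_mul, ← integral_complex_ofReal] at h
    push_cast at h
    rw [Complex.ofReal_cpow hr0.le] at h
    exact h
  exact ha.eqOn_of_preconnected_of_frequently_eq (analyticOnNhd_const) hconn
    (show (1:ℂ) ∈ {z : ℂ | 0 < z.re} by simp) hfr hz

lemma laplace_bdry (β : ℝ) (hβ0 : 0 < β) (hβ1 : β < 1) (ω : ℝ) (hω : 0 < ω) :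
    (1 + (Complex.I * ω) ^ (β:ℂ)) *
      ∫ x in Ioi (0:ℝ), Complex.exp (-(Complex.I * ω * x)) * (fML β x : ℂ) = 1 := by
  have hfc : Integrable (fun x => (fML β x : ℂ)) (volume.restrict (Ioi 0)) :=
    (fML_integrable β hβ0 hβ1).ofReal
  let p : ℝ → ℂ := fun e => (e : ℂ) + Complex.I * ω
  have hp : Continuous p := by fun_prop
  have hp0 : p 0 = Complex.I * ω := by simp [p]
  have h1 : Tendsto (fun e : ℝ => ∫ x in Ioi (0:ℝ), Complex.exp (-(p e * x)) * (fML β x : ℂ))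
      (nhdsWithin 0 (Ioi 0))
      (nhds (∫ x in Ioi (0:ℝ), Complex.exp (-(p 0 * x)) * (fML β x : ℂ))) := by
    apply tendsto_integral_filter_of_dominated_convergence (fun x => ‖(fML β x : ℂ)‖)
    · refine Eventually.of_forall fun e => ?_
      exact (by fun_prop : Continuous fun x : ℝ =>
        Complex.exp (-(p e * x))).aestronglyMeasurable.mul hfc.aestronglyMeasurable
    · filter_upwards [self_mem_nhdsWithin] with e he
      have he0 : (0:ℝ) < e := he
      filter_upwards [ae_restrict_mem measurableSet_Ioi] with x hx
      have hx0 : (0:ℝ) < x := hx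
      rw [norm_mul]
      refine mul_le_of_le_one_left (norm_nonneg _) ?_
      rw [Complex.norm_exp, Real.exp_le_one_iff]
      simp [p]
      positivity
    · exact hfc.norm
    · refine Eventually.of_forall fun x => ?_
      have : Continuous fun e : ℝ => Complex.exp (-(p e * x)) * (fML β x : ℂ) := by fun_prop
      exact (this.tendsto 0).mono_left nhdsWithin_le_nhds
  have h2 : Tendsto (fun e : ℝ => 1 + (p e) ^ (β:ℂ)) (nhdsWithin 0 (Ioi 0))
      (nhds (1 + (p 0) ^ (β:ℂ))) := by
    have hs : p 0 ∈ Complex.slitPlane := by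
      rw [hp0, Complex.mem_slitPlane_iff]
      right
      simpa using hω.ne'
    have : ContinuousAt (fun e : ℝ => 1 + (p e) ^ (β:ℂ)) 0 :=
      continuousAt_const.add (hp.continuousAt.cpow continuousAt_const hs)
    exact this.tendsto.mono_left nhdsWithin_le_nhds
  have h3 := h2.mul h1
  have h4 : Tendsto (fun e : ℝ => (1 + (p e) ^ (β:ℂ)) *
      ∫ x in Ioi (0:ℝ), Complex.exp (-(p e * x)) * (fML β x : ℂ)) (nhdsWithin 0 (Ioi 0))
      (nhds 1) := by
    refine tendsto_const_nhds.congr' ?_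
    filter_upwards [self_mem_nhdsWithin] with e he
    have he0 : (0:ℝ) < e := he
    exact (laplace_half β hβ0 hβ1 (p e) (by simpa [p] using he0)).symm
  have h5 := tendsto_nhds_unique h3 h4
  rwa [hp0] at h5

lemma fML_one (t : ℝ) : fML 1 t = Real.exp (-t) := by
  simp only [fML, ML2, sub_self, Real.rpow_zero, one_mul, Real.rpow_one, mul_one]
  rw [Real.exp_eq_exp_ℝ, NormedSpace.exp_eq_tsum_div]
  congr 1
  funext n
  rw [Real.Gamma_nat_eq_factorial]

/-- Fourier–Laplace transform of the exciting kernel `α f_β`: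
`∫_0^∞ e^{-iωτ} α f_β(τ) dτ = α / (1 + (iω)^β)` for `β ∈ (0,1]`, `α > 0`, `ω > 0`,
with the principal branch of the complex power. -/
theorem fourier_exciting_kernel (β α : ℝ) (hβ : β ∈ Set.Ioc (0:ℝ) 1) (hα : 0 < α)
    (ω : ℝ) (hω : 0 < ω) :
    ∫ τ in Set.Ioi (0:ℝ),
        Complex.exp (-(Complex.I * (ω : ℂ) * (τ : ℂ))) * ((α * fML β τ : ℝ) : ℂ) =
      (α : ℂ) / (1 + (Complex.I * (ω : ℂ)) ^ (β : ℂ)) := by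
  obtain ⟨hβ0, hβ1⟩ := hβ
  have hred : ∫ τ in Set.Ioi (0:ℝ),
        Complex.exp (-(Complex.I * (ω : ℂ) * (τ : ℂ))) * ((α * fML β τ : ℝ) : ℂ) =
      (α : ℂ) * ∫ τ in Set.Ioi (0:ℝ),
        Complex.exp (-(Complex.I * (ω : ℂ) * (τ : ℂ))) * (fML β τ : ℂ) := by
    rw [← integral_const_mul]
    congr 1
    funext τ
    push_cast
    ring
  rw [hred]
  rcases hβ1.lt_or_eq with hlt | rfl
  · have h := laplace_bdry β hβ0 hlt ω hω
    have hne : (1 + (Complex.I * (ω:ℂ)) ^ (β : ℂ)) ≠ 0 := by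
      intro h0
      rw [h0, zero_mul] at h
      exact zero_ne_one h
    rw [eq_div_iff hne, mul_assoc, mul_comm (∫ _ in _, _), h, mul_one]
  · have hre : (-(1 + Complex.I * (ω:ℂ))).re < 0 := by simp
    have h := integral_exp_mul_complex_Ioi hre 0
    have e : ∫ τ in Set.Ioi (0:ℝ),
        Complex.exp (-(Complex.I * (ω : ℂ) * (τ : ℂ))) * (fML 1 τ : ℂ) =
        ∫ τ in Set.Ioi (0:ℝ), Complex.exp (-(1 + Complex.I * (ω:ℂ)) * τ) := by
      congr 1
      funext τ
      rw [fML_one, Complex.ofReal_exp, ← Complex.exp_add]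
      congr 1
      push_cast
      ring
    rw [e, h]
    rw [Complex.ofReal_zero, mul_zero, Complex.exp_zero, neg_div_neg_eq, Complex.ofReal_one,
      Complex.cpow_one, mul_one_div]
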